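/- Assume (A1): f,g:[0,1]×ℝ²→ℝ are continuous and there exist L₁,L₂>0 with |f(t,x₁,y₁)−f(t,x₂,y₂)| ≤ L₁(|x₁−x₂|+|y₁−y₂|) and |g(t,x₁,y₁)−g(t,x₂,y₂)| ≤ L₂(|x₁−x₂|+|y₁−y₂|) for all t∈[0,1] and x₁,x₂,y₁,y₂∈ℝ. Set γ₃ = (L₁/Γ(α+1))[(ψ(1)−ψ(0))^α + ((λ+1)/|Δ₁|)(ψ(1)−ψ(0))^{α+1}] and γ₄ = (L₂/Γ(β+1))[(ψ(1)−ψ(0))^β + ((μ+1)/|Δ₂|)(ψ(1)−ψ(0))^{β+1}]. Then for all continuous x₁,y₁,x₂,y₂:[0,1]→ℝ, ‖T₁(x₁,y₁)−T₁(x₂,y₂)‖ + ‖T₂(x₁,y₁)−T₂(x₂,y₂)‖ ≤ (γ₃+γ₄)(‖x₁−x₂‖+‖y₁−y₂‖); in particular, if γ₃+γ₄ < 1 then T = (T₁,T₂) is a contraction on C([0,1],ℝ)×C([0,1],ℝ) with the norm ‖(x,y)‖ = ‖x‖+‖y‖. -/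

import Mathlib

open MeasureTheory intervalIntegral Set

/-- The sup norm of a function on `[0,1]`. -/
noncomputable def supNorm (x : ℝ → ℝ) : ℝ := ⨆ t : Set.Icc (0:ℝ) 1, |x ↑t|

/-- The operator `T₁` (and, with the parameters `(β, ξ, μ, Δ₂, g)`, the operator `T₂`)
associated with the four-point boundary value problem:
`T₁(x,y)(t) = (1/Γ(α)) ∫₀ᵗ ψ'(s)(ψ(t)−ψ(s))^{α−1} f(s,x(s),y(s)) ds
  + (1/Δ₁)[ (1/Γ(α)) ∫₀¹ ψ'(s)(ψ(1)−ψ(s))^{α−1} f(s,x(s),y(s)) ds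
  − (λ/Γ(α)) ∫₀^η ψ'(s)(ψ(η)−ψ(s))^{α−1} f(s,x(s),y(s)) ds ] (ψ(t)−ψ(0))`. -/
noncomputable def Tmap (ψ : ℝ → ℝ) (α η lam Δ : ℝ) (f : ℝ → ℝ → ℝ → ℝ)
    (x y : ℝ → ℝ) (t : ℝ) : ℝ :=
  (1 / Real.Gamma α) * (∫ s in (0:ℝ)..t, deriv ψ s * (ψ t - ψ s) ^ (α - 1) * f s (x s) (y s))
  + (1 / Δ) *
      ((1 / Real.Gamma α) *
          (∫ s in (0:ℝ)..1, deriv ψ s * (ψ 1 - ψ s) ^ (α - 1) * f s (x s) (y s))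
        - (lam / Real.Gamma α) *
          (∫ s in (0:ℝ)..η, deriv ψ s * (ψ η - ψ s) ^ (α - 1) * f s (x s) (y s)))
    * (ψ t - ψ 0)

lemma abs_le_supNorm {x : ℝ → ℝ} (hx : ContinuousOn x (Icc 0 1)) {t : ℝ} (ht : t ∈ Icc (0:ℝ) 1) :
    |x t| ≤ supNorm x := by
  have hbdd : BddAbove (range fun s : Icc (0:ℝ) 1 => |x s|) := by
    have h := (isCompact_Icc (a := (0:ℝ)) (b := 1)).bddAbove_image hx.abs
    rwa [image_eq_range] at h
  exact le_ciSup hbdd ⟨t, ht⟩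

lemma supNorm_le {x : ℝ → ℝ} {C : ℝ} (h : ∀ t ∈ Icc (0:ℝ) 1, |x t| ≤ C) : supNorm x ≤ C :=
  haveI : Nonempty (Icc (0:ℝ) 1) := ⟨⟨0, by simp⟩⟩
  ciSup_le fun t => h t t.2

lemma continuousOn_deriv_of_deriv_ne_zero {ψ : ℝ → ℝ} (hψC1 : ContDiffOn ℝ 1 ψ (Icc 0 1))
    (hψ' : ∀ t ∈ Icc (0:ℝ) 1, deriv ψ t ≠ 0) : ContinuousOn (deriv ψ) (Icc 0 1) := by
  have hu : UniqueDiffOn ℝ (Icc (0:ℝ) 1) := uniqueDiffOn_Icc one_pos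
  refine (hψC1.continuousOn_derivWithin hu le_rfl).congr fun t ht => ?_
  exact ((differentiableAt_of_deriv_ne_zero (hψ' t ht)).derivWithin (hu t ht)).symm

lemma deriv_nonneg_of_strictMonoOn {ψ : ℝ → ℝ} (hψmono : StrictMonoOn ψ (Icc 0 1))
    (hψ' : ∀ t ∈ Icc (0:ℝ) 1, deriv ψ t ≠ 0) {t : ℝ} (ht : t ∈ Icc (0:ℝ) 1) :
    0 ≤ deriv ψ t := by
  rw [← (differentiableAt_of_deriv_ne_zero (hψ' t ht)).derivWithin (uniqueDiffOn_Icc one_pos t ht)]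
  exact hψmono.monotoneOn.derivWithin_nonneg

/-- The kernel `ψ'(s)(ψ(t)−ψ(s))^{α−1}` of the `ψ`-fractional integral is continuous on `[0,1]`. -/
lemma continuousOn_kernel {ψ : ℝ → ℝ} (hψC1 : ContDiffOn ℝ 1 ψ (Icc 0 1))
    (hψ' : ∀ t ∈ Icc (0:ℝ) 1, deriv ψ t ≠ 0) {α : ℝ} (hα : 1 < α) (t : ℝ) :
    ContinuousOn (fun s => deriv ψ s * (ψ t - ψ s) ^ (α - 1)) (Icc 0 1) :=
  (continuousOn_deriv_of_deriv_ne_zero hψC1 hψ').mul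
    ((continuousOn_const.sub hψC1.continuousOn).rpow_const fun _ _ => Or.inr (by linarith))

lemma integral_kernel {ψ : ℝ → ℝ} (hψC1 : ContDiffOn ℝ 1 ψ (Icc 0 1))
    (hψ' : ∀ t ∈ Icc (0:ℝ) 1, deriv ψ t ≠ 0) {α : ℝ} (hα : 1 < α) {t : ℝ}
    (ht : t ∈ Icc (0:ℝ) 1) :
    ∫ s in (0:ℝ)..t, deriv ψ s * (ψ t - ψ s) ^ (α - 1) = (ψ t - ψ 0) ^ α / α := by
  have hsub : uIcc 0 t ⊆ Icc 0 1 := by rw [uIcc_of_le ht.1]; exact Icc_subset_Icc_right ht.2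
  have hderiv : ∀ s ∈ uIcc 0 t, HasDerivAt (fun s => -((ψ t - ψ s) ^ α / α))
      (deriv ψ s * (ψ t - ψ s) ^ (α - 1)) s := fun s hs => by
    have h := (differentiableAt_of_deriv_ne_zero (hψ' s (hsub hs))).hasDerivAt
    refine (((h.const_sub (ψ t)).rpow_const (Or.inr hα.le)).div_const α).neg.congr_deriv ?_
    field_simp
  rw [integral_eq_sub_of_hasDerivAt hderiv
    (((continuousOn_kernel hψC1 hψ' hα t).mono hsub).intervalIntegrable)]
  simp [Real.zero_rpow (by linarith : α ≠ 0)]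

lemma abs_integral_kernel_sub_le {ψ : ℝ → ℝ} (hψmono : StrictMonoOn ψ (Icc 0 1))
    (hψC1 : ContDiffOn ℝ 1 ψ (Icc 0 1)) (hψ' : ∀ t ∈ Icc (0:ℝ) 1, deriv ψ t ≠ 0)
    {α : ℝ} (hα : 1 < α) {u v : ℝ → ℝ} (hu : ContinuousOn u (Icc 0 1))
    (hv : ContinuousOn v (Icc 0 1)) {M : ℝ} (hM : ∀ s ∈ Icc (0:ℝ) 1, |u s - v s| ≤ M)
    {t : ℝ} (ht : t ∈ Icc (0:ℝ) 1) :
    |(∫ s in (0:ℝ)..t, deriv ψ s * (ψ t - ψ s) ^ (α - 1) * u s) -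
      ∫ s in (0:ℝ)..t, deriv ψ s * (ψ t - ψ s) ^ (α - 1) * v s| ≤
      (ψ t - ψ 0) ^ α / α * M := by
  have hsub : uIcc 0 t ⊆ Icc 0 1 := by rw [uIcc_of_le ht.1]; exact Icc_subset_Icc_right ht.2
  have hk := continuousOn_kernel hψC1 hψ' hα t
  have hint : ∀ {w : ℝ → ℝ}, ContinuousOn w (Icc 0 1) → IntervalIntegrable
      (fun s => deriv ψ s * (ψ t - ψ s) ^ (α - 1) * w s) volume 0 t := fun hw =>
    ((hk.mul hw).mono hsub).intervalIntegrable
  rw [← intervalIntegral.integral_sub (hint hu) (hint hv), ← integral_kernel hψC1 hψ' hα ht,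
    ← intervalIntegral.integral_mul_const, ← Real.norm_eq_abs]
  refine norm_integral_le_of_norm_le ht.1 (ae_of_all _ fun s hs => ?_)
    (hint continuousOn_const)
  have hs' : s ∈ Icc (0:ℝ) 1 := ⟨hs.1.le, hs.2.trans ht.2⟩
  have hnn : 0 ≤ deriv ψ s * (ψ t - ψ s) ^ (α - 1) :=
    mul_nonneg (deriv_nonneg_of_strictMonoOn hψmono hψ' hs')
      (Real.rpow_nonneg (sub_nonneg.2 (hψmono.monotoneOn hs' ht hs.2)) _)
  rw [← mul_sub, Real.norm_eq_abs, abs_mul, abs_of_nonneg hnn]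
  exact mul_le_mul_of_nonneg_left (hM s hs') hnn

lemma supNorm_Tmap_sub_le {ψ : ℝ → ℝ} (hψmono : StrictMonoOn ψ (Icc 0 1))
    (hψC1 : ContDiffOn ℝ 1 ψ (Icc 0 1)) (hψ' : ∀ t ∈ Icc (0:ℝ) 1, deriv ψ t ≠ 0)
    {α η lam : ℝ} (hα : 1 < α) (hη : η ∈ Icc (0:ℝ) 1) (hlam : 0 ≤ lam) (Δ : ℝ)
    {f : ℝ → ℝ → ℝ → ℝ}
    (hfc : ContinuousOn (fun p : ℝ × ℝ × ℝ => f p.1 p.2.1 p.2.2)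
      (Icc 0 1 ×ˢ (univ : Set (ℝ × ℝ))))
    {L : ℝ} (hL : 0 ≤ L)
    (hflip : ∀ t ∈ Icc (0:ℝ) 1, ∀ x₁ y₁ x₂ y₂ : ℝ,
      |f t x₁ y₁ - f t x₂ y₂| ≤ L * (|x₁ - x₂| + |y₁ - y₂|))
    {x₁ y₁ x₂ y₂ : ℝ → ℝ} (hx₁ : ContinuousOn x₁ (Icc 0 1)) (hy₁ : ContinuousOn y₁ (Icc 0 1))
    (hx₂ : ContinuousOn x₂ (Icc 0 1)) (hy₂ : ContinuousOn y₂ (Icc 0 1)) :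
    supNorm (fun t => Tmap ψ α η lam Δ f x₁ y₁ t - Tmap ψ α η lam Δ f x₂ y₂ t) ≤
      (L / Real.Gamma (α + 1)) *
        ((ψ 1 - ψ 0) ^ α + ((lam + 1) / |Δ|) * (ψ 1 - ψ 0) ^ (α + 1)) *
        (supNorm (fun t => x₁ t - x₂ t) + supNorm (fun t => y₁ t - y₂ t)) := by
  refine supNorm_le fun t ht => ?_
  set N := supNorm (fun t => x₁ t - x₂ t) + supNorm (fun t => y₁ t - y₂ t)
  have hfcomp : ∀ {x y : ℝ → ℝ}, ContinuousOn x (Icc 0 1) → ContinuousOn y (Icc 0 1) →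
      ContinuousOn (fun s => f s (x s) (y s)) (Icc 0 1) := fun hx hy =>
    hfc.comp (continuousOn_id.prodMk (hx.prodMk hy)) fun s hs => ⟨hs, mem_univ _⟩
  have hM : ∀ s ∈ Icc (0:ℝ) 1, |f s (x₁ s) (y₁ s) - f s (x₂ s) (y₂ s)| ≤ L * N := fun s hs =>
    (hflip s hs _ _ _ _).trans <| mul_le_mul_of_nonneg_left
      (add_le_add (abs_le_supNorm (hx₁.sub hx₂) hs) (abs_le_supNorm (hy₁.sub hy₂) hs)) hL
  have h0 : (0:ℝ) ∈ Icc (0:ℝ) 1 := by simp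
  have h1 : (1:ℝ) ∈ Icc (0:ℝ) 1 := by simp
  have hLN : 0 ≤ L * N := (abs_nonneg _).trans (hM 0 h0)
  have hα0 : 0 < α := by linarith
  have hD : ∀ r ∈ Icc (0:ℝ) 1, 0 ≤ ψ r - ψ 0 ∧ ψ r - ψ 0 ≤ ψ 1 - ψ 0 := fun r hr =>
    ⟨sub_nonneg.2 (hψmono.monotoneOn h0 hr hr.1),
      sub_le_sub_right (hψmono.monotoneOn hr h1 hr.2) _⟩
  have hI : ∀ r ∈ Icc (0:ℝ) 1,
      |(∫ s in (0:ℝ)..r, deriv ψ s * (ψ r - ψ s) ^ (α - 1) * f s (x₁ s) (y₁ s)) -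
        ∫ s in (0:ℝ)..r, deriv ψ s * (ψ r - ψ s) ^ (α - 1) * f s (x₂ s) (y₂ s)| ≤
        (ψ 1 - ψ 0) ^ α / α * (L * N) := fun r hr =>
    (abs_integral_kernel_sub_le hψmono hψC1 hψ' hα (hfcomp hx₁ hy₁) (hfcomp hx₂ hy₂) hM hr).trans
      (by gcongr; exacts [(hD r hr).1, hψmono.monotoneOn hr h1 hr.2])
  have hIt := hI t ht
  have hI1 := hI 1 h1
  have hIη := hI η hη
  obtain ⟨hDt0, hDt⟩ := hD t ht
  have hD1 := (hD 1 h1).1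
  simp only [Tmap]
  generalize (∫ s in (0:ℝ)..t, deriv ψ s * (ψ t - ψ s) ^ (α - 1) * f s (x₁ s) (y₁ s)) = a₁ at *
  generalize (∫ s in (0:ℝ)..t, deriv ψ s * (ψ t - ψ s) ^ (α - 1) * f s (x₂ s) (y₂ s)) = a₂ at *
  generalize (∫ s in (0:ℝ)..1, deriv ψ s * (ψ 1 - ψ s) ^ (α - 1) * f s (x₁ s) (y₁ s)) = b₁ at *
  generalize (∫ s in (0:ℝ)..1, deriv ψ s * (ψ 1 - ψ s) ^ (α - 1) * f s (x₂ s) (y₂ s)) = b₂ at *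
  generalize (∫ s in (0:ℝ)..η, deriv ψ s * (ψ η - ψ s) ^ (α - 1) * f s (x₁ s) (y₁ s)) = c₁ at *
  generalize (∫ s in (0:ℝ)..η, deriv ψ s * (ψ η - ψ s) ^ (α - 1) * f s (x₂ s) (y₂ s)) = c₂ at *
  have hΓ : 0 < Real.Gamma α := Real.Gamma_pos_of_pos hα0
  set K := (ψ 1 - ψ 0) ^ α / α * (L * N) with hK
  have hK0 : 0 ≤ K := (abs_nonneg _).trans hIt
  have hbc : |(b₁ - b₂) - lam * (c₁ - c₂)| ≤ K + lam * K := by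
    refine (abs_sub _ _).trans (add_le_add hI1 ?_)
    rw [abs_mul, abs_of_nonneg hlam]
    exact mul_le_mul_of_nonneg_left hIη hlam
  calc _ = |1 / Real.Gamma α * ((a₁ - a₂) +
        1 / Δ * ((b₁ - b₂) - lam * (c₁ - c₂)) * (ψ t - ψ 0))| := by congr 1; ring
    _ ≤ 1 / Real.Gamma α * (K + 1 / |Δ| * (K + lam * K) * (ψ 1 - ψ 0)) := by
        rw [abs_mul, abs_of_pos (one_div_pos.2 hΓ)]
        gcongr
        refine (abs_add_le _ _).trans (add_le_add hIt ?_)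
        rw [abs_mul, abs_mul, abs_one_div, abs_of_nonneg hDt0]
        gcongr
    _ = _ := by
        rw [Real.Gamma_add_one hα0.ne', Real.rpow_add_one' hD1 (by linarith), hK]
        field_simp
        ring

/-- **Contraction estimate for the operator `T = (T₁,T₂)`.**
Under (A1), `‖T₁(x₁,y₁)−T₁(x₂,y₂)‖ + ‖T₂(x₁,y₁)−T₂(x₂,y₂)‖
≤ (γ₃+γ₄)(‖x₁−x₂‖+‖y₁−y₂‖)`; in particular `T` is a contraction whenever `γ₃+γ₄ < 1`. -/
theorem T_contraction_estimate
    (α β η ξ lam μ Δ₁ Δ₂ : ℝ) (ψ : ℝ → ℝ) (f g : ℝ → ℝ → ℝ → ℝ)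
    (hψmono : StrictMonoOn ψ (Icc 0 1))
    (hψC1 : ContDiffOn ℝ 1 ψ (Icc 0 1))
    (hψ' : ∀ t ∈ Icc (0:ℝ) 1, deriv ψ t ≠ 0)
    (hα1 : 1 < α) (hα2 : α < 2) (hβ1 : 1 < β) (hβ2 : β < 2)
    (hη0 : 0 < η) (hη1 : η < 1) (hξ0 : 0 < ξ) (hξ1 : ξ < 1)
    (hlam : 0 < lam) (hμ : 0 < μ)
    (hΔ₁ : Δ₁ = lam * (ψ η - ψ 0) - (ψ 1 - ψ 0)) (hΔ₁0 : Δ₁ ≠ 0)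
    (hΔ₂ : Δ₂ = μ * (ψ ξ - ψ 0) - (ψ 1 - ψ 0)) (hΔ₂0 : Δ₂ ≠ 0)
    (hfc : ContinuousOn (fun p : ℝ × ℝ × ℝ => f p.1 p.2.1 p.2.2)
      (Icc 0 1 ×ˢ (univ : Set (ℝ × ℝ))))
    (hgc : ContinuousOn (fun p : ℝ × ℝ × ℝ => g p.1 p.2.1 p.2.2)
      (Icc 0 1 ×ˢ (univ : Set (ℝ × ℝ))))
    (L₁ L₂ : ℝ) (hL₁ : 0 < L₁) (hL₂ : 0 < L₂)
    (hflip : ∀ t ∈ Icc (0:ℝ) 1, ∀ x₁ y₁ x₂ y₂ : ℝ,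
      |f t x₁ y₁ - f t x₂ y₂| ≤ L₁ * (|x₁ - x₂| + |y₁ - y₂|))
    (hglip : ∀ t ∈ Icc (0:ℝ) 1, ∀ x₁ y₁ x₂ y₂ : ℝ,
      |g t x₁ y₁ - g t x₂ y₂| ≤ L₂ * (|x₁ - x₂| + |y₁ - y₂|))
    (γ₃ γ₄ : ℝ)
    (hγ₃ : γ₃ = (L₁ / Real.Gamma (α + 1)) *
      ((ψ 1 - ψ 0) ^ α + ((lam + 1) / |Δ₁|) * (ψ 1 - ψ 0) ^ (α + 1)))
    (hγ₄ : γ₄ = (L₂ / Real.Gamma (β + 1)) *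
      ((ψ 1 - ψ 0) ^ β + ((μ + 1) / |Δ₂|) * (ψ 1 - ψ 0) ^ (β + 1))) :
    ∀ x₁ y₁ x₂ y₂ : ℝ → ℝ,
      ContinuousOn x₁ (Icc 0 1) → ContinuousOn y₁ (Icc 0 1) →
      ContinuousOn x₂ (Icc 0 1) → ContinuousOn y₂ (Icc 0 1) →
      supNorm (fun t => Tmap ψ α η lam Δ₁ f x₁ y₁ t - Tmap ψ α η lam Δ₁ f x₂ y₂ t)
        + supNorm (fun t => Tmap ψ β ξ μ Δ₂ g x₁ y₁ t - Tmap ψ β ξ μ Δ₂ g x₂ y₂ t) ≤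
      (γ₃ + γ₄) * (supNorm (fun t => x₁ t - x₂ t) + supNorm (fun t => y₁ t - y₂ t)) := by
  intro x₁ y₁ x₂ y₂ hx₁ hy₁ hx₂ hy₂
  rw [hγ₃, hγ₄, add_mul]
  exact add_le_add
    (supNorm_Tmap_sub_le hψmono hψC1 hψ' hα1 ⟨hη0.le, hη1.le⟩ hlam.le Δ₁ hfc hL₁.le hflip
      hx₁ hy₁ hx₂ hy₂)
    (supNorm_Tmap_sub_le hψmono hψC1 hψ' hβ1 ⟨hξ0.le, hξ1.le⟩ hμ.le Δ₂ hgc hL₂.le hglip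
      hx₁ hy₁ hx₂ hy₂)
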